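/- arXiv:2309.04910 — 10 statements merged into one kernel-verified Lean document; each statement's English description precedes it below -/
import Mathlib

section
/- Let r, s ≥ 1 and let a : Fin r → Matrix (Fin d1) (Fin d1) ℂ, b : Fin r → Matrix (Fin d2) (Fin d2) ℂ, c : Fin s → Matrix (Fin d1) (Fin d1) ℂ, e : Fin s → Matrix (Fin d2) (Fin d2) ℂ be families of complex matrices such that the family (b_k)_{k} is linearly independent, the family (e_l)_{l} is linearly independent, and ∑_{k} a_k ⊗ₖ b_k = ∑_{l} c_l ⊗ₖ e_l. Then the star-subalgebra of Matrix (Fin d1) (Fin d1) ℂ generated by {a_k : k} equals the star-subalgebra generated by {c_l : l}. -/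
open Kronecker

/-- If `∑ k, a k ⊗ₖ b k = ∑ l, c l ⊗ₖ e l` with `b` linearly independent, then every `a k` lies
in the linear span of the family `c`. -/
theorem mem_span_range_of_sum_kronecker_eq {K m n p q ι κ : Type*} [Field K] [Fintype ι]
    [Fintype κ] {a : ι → Matrix m n K} {b : ι → Matrix p q K}
    {c : κ → Matrix m n K} {e : κ → Matrix p q K} (hb : LinearIndependent K b)
    (heq : ∑ k, a k ⊗ₖ b k = ∑ l, c l ⊗ₖ e l) (k : ι) :
    a k ∈ Submodule.span K (Set.range c) := by
  obtain ⟨g, hg⟩ := LinearMap.exists_leftInverse_of_injective (Fintype.linearCombination K b)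
    (LinearMap.ker_eq_bot.mpr hb.fintypeLinearCombination_injective)
  have key (i : m) (j : n) : ∑ k, a k i j • b k = ∑ l, c l i j • e l := by
    ext x y
    simpa [Matrix.sum_apply] using congrFun (congrFun heq (i, x)) (j, y)
  have hak : a k = ∑ l, g (e l) k • c l := by
    ext i j
    have h := congrFun (LinearMap.congr_fun hg fun k => a k i j) k
    rw [LinearMap.comp_apply, Fintype.linearCombination_apply, key] at h
    simpa [Matrix.sum_apply, mul_comm] using h.symm
  rw [hak]
  exact Submodule.sum_mem _ fun l _ =>
    Submodule.smul_mem _ _ (Submodule.subset_span (Set.mem_range_self l))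

/-- A star-subalgebra generated by elements of the linear span of `t` is contained in the
star-subalgebra generated by `t`. -/
theorem starAlgebra_adjoin_le_of_subset_span {R A : Type*} [CommSemiring R] [StarRing R]
    [Semiring A] [StarRing A] [Algebra R A] [StarModule R A] {s t : Set A}
    (h : s ⊆ Submodule.span R t) : StarAlgebra.adjoin R s ≤ StarAlgebra.adjoin R t := by
  have hspan : Submodule.span R t ≤
      Subalgebra.toSubmodule (StarAlgebra.adjoin R t).toSubalgebra :=
    Submodule.span_le.mpr (StarAlgebra.subset_adjoin R t)
  exact StarAlgebra.adjoin_le fun x hx => hspan (h hx)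

/-- Well-definedness of the induced algebra: if `∑ k, a k ⊗ₖ b k = ∑ l, c l ⊗ₖ e l` with
`b` and `e` linearly independent families, then the star-subalgebras generated by the
first factors coincide. -/
theorem induced_algebra_well_defined {d1 d2 r s : ℕ} (hr : 1 ≤ r) (hs : 1 ≤ s)
    (a : Fin r → Matrix (Fin d1) (Fin d1) ℂ)
    (b : Fin r → Matrix (Fin d2) (Fin d2) ℂ)
    (c : Fin s → Matrix (Fin d1) (Fin d1) ℂ)
    (e : Fin s → Matrix (Fin d2) (Fin d2) ℂ)
    (hb : LinearIndependent ℂ b) (he : LinearIndependent ℂ e)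
    (heq : ∑ k, a k ⊗ₖ b k = ∑ l, c l ⊗ₖ e l) :
    StarAlgebra.adjoin ℂ (Set.range a) = StarAlgebra.adjoin ℂ (Set.range c) := by
  apply le_antisymm <;> apply starAlgebra_adjoin_le_of_subset_span
  · rintro _ ⟨k, rfl⟩
    exact mem_span_range_of_sum_kronecker_eq hb heq k
  · rintro _ ⟨l, rfl⟩
    exact mem_span_range_of_sum_kronecker_eq he heq.symm l
end

section
/- Let A and A' be star-subalgebras of Matrix (Fin d) (Fin d) ℂ that commute elementwise, i.e. x*y = y*x for all x ∈ A and y ∈ A'. Suppose there exist h ∈ A and h' ∈ A' with h ≠ 0, h' ≠ 0 and h*h' = 0. Then there exists a linear subspace V of ℂ^d with V ≠ {0} and V ≠ ℂ^d such that x·v ∈ V for every x ∈ A and v ∈ V, and y·v ∈ V for every y ∈ A' and v ∈ V. -/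
/-- Non-trivial decomposition lemma: two elementwise-commuting star-subalgebras of the
`d × d` complex matrices containing nonzero elements `h, h'` with `h * h' = 0` admit a
common non-trivial proper invariant subspace. -/
theorem commuting_star_subalgebras_common_invariant_subspace {d : ℕ}
    (A A' : StarSubalgebra ℂ (Matrix (Fin d) (Fin d) ℂ))
    (hcomm : ∀ x ∈ A, ∀ y ∈ A', x * y = y * x)
    (h h' : Matrix (Fin d) (Fin d) ℂ)
    (hA : h ∈ A) (hA' : h' ∈ A') (hne : h ≠ 0) (hne' : h' ≠ 0)
    (hzero : h * h' = 0) :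
    ∃ V : Submodule ℂ (Fin d → ℂ), V ≠ ⊥ ∧ V ≠ ⊤ ∧
      (∀ x ∈ A, ∀ v ∈ V, x.mulVec v ∈ V) ∧
      (∀ y ∈ A', ∀ v ∈ V, y.mulVec v ∈ V) := by
  let V : Submodule ℂ (Fin d → ℂ) :=
    { carrier := {v | ∀ x ∈ A, (h * x).mulVec v = 0}
      add_mem' := fun {u v} hu hv x hx => by
        rw [Matrix.mulVec_add, hu x hx, hv x hx, add_zero]
      zero_mem' := fun x _ => Matrix.mulVec_zero _
      smul_mem' := fun c v hv x hx => by
        rw [Matrix.mulVec_smul, hv x hx, smul_zero] }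
  refine ⟨V, ?_, ?_, ?_, ?_⟩
  · intro hbot
    refine hne' (Matrix.mulVec_injective (funext fun w => ?_))
    have hmem : h'.mulVec w ∈ V := fun x hx => by
      rw [Matrix.mulVec_mulVec, mul_assoc, hcomm x hx h' hA', ← mul_assoc, hzero, zero_mul,
        Matrix.zero_mulVec]
    rw [hbot, Submodule.mem_bot] at hmem
    rw [hmem, Matrix.zero_mulVec]
  · intro htop
    refine hne (Matrix.mulVec_injective (funext fun w => ?_))
    have hmem : w ∈ V := htop ▸ Submodule.mem_top
    have hw := hmem 1 (one_mem A)
    rw [mul_one] at hw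
    rw [hw, Matrix.zero_mulVec]
  · intro x hx v hv z hz
    rw [Matrix.mulVec_mulVec, mul_assoc]
    exact hv (z * x) (mul_mem hz hx)
  · intro y hy v hv z hz
    rw [Matrix.mulVec_mulVec, hcomm (h * z) (mul_mem hA hz) y hy, ← Matrix.mulVec_mulVec,
      hv z hz, Matrix.mulVec_zero]
end

section
/- Let H be a finite-dimensional complex inner product space, let h_0, h_1, …, h_m be pairwise commuting orthogonal projections on H, and let Π be an orthogonal projection on H with Π∘h_i = h_i∘Π for every i ∈ {1,…,m} (no commutation is assumed between Π and h_0). Define g_i := Π∘h_i∘Π for 1 ≤ i ≤ m, and let g_0 be the orthogonal projection onto the 1-eigenspace of Π∘h_0∘Π. Then g_0, g_1, …, g_m are orthogonal projections and they pairwise commute. -/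
/-- A self-adjoint idempotent `g` whose fixed vectors are those of `M` commutes with every
self-adjoint operator commuting with `M`. -/
theorem commute_of_fixed_iff {𝕜 H : Type*} [RCLike 𝕜] [NormedAddCommGroup H]
    [InnerProductSpace 𝕜 H] [FiniteDimensional 𝕜 H] {A M g : Module.End 𝕜 H}
    (hA : IsSelfAdjoint A) (hg : IsSelfAdjoint g) (hgg : IsIdempotentElem g)
    (hfix : ∀ v, g v = v ↔ M v = v) (hAM : Commute A M) : Commute A g := by
  have hgAg : g * (A * g) = A * g := by
    ext v
    have hM : M (g v) = g v := (hfix _).1 (LinearMap.congr_fun hgg.eq v)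
    have hMA : M (A (g v)) = A (g v) := by
      rw [← Module.End.mul_apply M A, ← hAM.eq, Module.End.mul_apply, hM]
    exact (hfix _).2 hMA
  have hstar := congrArg star hgAg
  simp only [star_mul, hA.star_eq, hg.star_eq] at hstar
  rw [commute_iff_eq, ← hgAg, ← mul_assoc, hstar]


/-- Lemma 4.3: given pairwise commuting orthogonal projections `h 0, …, h m` and an
orthogonal projection `P` commuting with every `h i` except possibly `h 0`, the reduced
terms `g i = P ∘ h i ∘ P` (for `i ≠ 0`) and `g 0` = the projection onto the 1-eigenspace
of `P ∘ h 0 ∘ P` are again pairwise commuting orthogonal projections. -/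
theorem reduced_terms_commuting_projections {H : Type*} [NormedAddCommGroup H]
    [InnerProductSpace ℂ H] [FiniteDimensional ℂ H] {m : ℕ}
    (h : Fin (m + 1) → H →ₗ[ℂ] H)
    (hsa : ∀ i, IsSelfAdjoint (h i)) (hproj : ∀ i, h i ∘ₗ h i = h i)
    (hcomm : ∀ i j, h i ∘ₗ h j = h j ∘ₗ h i)
    (P : H →ₗ[ℂ] H) (hPsa : IsSelfAdjoint P) (hPproj : P ∘ₗ P = P)
    (hPcomm : ∀ i, i ≠ 0 → P ∘ₗ h i = h i ∘ₗ P)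
    (g0 : H →ₗ[ℂ] H) (hg0sa : IsSelfAdjoint g0) (hg0proj : g0 ∘ₗ g0 = g0)
    (hg0fix : ∀ v : H, g0 v = v ↔ (P ∘ₗ h 0 ∘ₗ P) v = v) :
    ∀ g : Fin (m + 1) → H →ₗ[ℂ] H,
      g 0 = g0 → (∀ i, i ≠ 0 → g i = P ∘ₗ h i ∘ₗ P) →
      (∀ i, IsSelfAdjoint (g i) ∧ g i ∘ₗ g i = g i) ∧
      (∀ i j, g i ∘ₗ g j = g j ∘ₗ g i) := by
  have hPP : IsIdempotentElem P := hPproj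
  have hPh (i) (hi : i ≠ 0) : Commute P (h i) := hPcomm i hi
  have hhh (i j) : Commute (h i) (h j) := hcomm i j
  have hPM (A : Module.End ℂ H) : Commute P (P * (A * P)) := by
    rw [commute_iff_eq, ← mul_assoc, hPP.eq, mul_assoc, mul_assoc, hPP.eq]
  have hcompress (i) (hi : i ≠ 0) (j) : Commute (P * (h i * P)) (P * (h j * P)) := by
    have hij : Commute (h i) (P * (h j * P)) :=
      (hPh i hi).symm.mul_right ((hhh i j).mul_right (hPh i hi).symm)
    exact (hPM _).mul_left (hij.mul_left (hPM _))
  have hcompress_sa (i) : IsSelfAdjoint (P * (h i * P)) := by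
    rw [isSelfAdjoint_iff, star_mul, star_mul, hPsa.star_eq, (hsa i).star_eq, mul_assoc]
  have hg0comm (i) (hi : i ≠ 0) : Commute (P * (h i * P)) g0 :=
    commute_of_fixed_iff (hcompress_sa i) hg0sa hg0proj hg0fix (hcompress i hi 0)
  intro g hgz hgi
  refine ⟨fun i => ?_, fun i j => ?_⟩
  · by_cases hi : i = 0
    · subst hi
      rw [hgz]
      exact ⟨hg0sa, hg0proj⟩
    · rw [hgi i hi]
      refine ⟨hcompress_sa i, ?_⟩
      have hidem : IsIdempotentElem (P * (h i * P)) :=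
        hPP.mul_of_commute ((hPh i hi).mul_right (Commute.refl P))
          (IsIdempotentElem.mul_of_commute (hPh i hi).symm (hproj i) hPP)
      exact hidem
  · by_cases hi : i = 0 <;> by_cases hj : j = 0
    · rw [hi, hj]
    · rw [hi, hgz, hgi j hj]
      exact (hg0comm j hj).symm
    · rw [hj, hgz, hgi i hi]
      exact hg0comm i hi
    · rw [hgi i hi, hgi j hj]
      exact hcompress i hi j
end

section
/- Let H be a finite-dimensional complex inner product space, let h_0, h_1, …, h_m be pairwise commuting orthogonal projections on H, and let Π_1, …, Π_k be orthogonal projections on H with Π_j∘Π_{j'} = 0 for j ≠ j', ∑_{j=1}^k Π_j = id_H, and Π_j∘h_i = h_i∘Π_j for every j ∈ {1,…,k} and every i ∈ {1,…,m} (no commutation is assumed between the Π_j and h_0). For each j define h_i^{(j)} := Π_j∘h_i∘Π_j for 1 ≤ i ≤ m, and let h_0^{(j)} be the orthogonal projection onto the 1-eigenspace of Π_j∘h_0∘Π_j. Then the following are equivalent: (a) there exists ψ ∈ H, ψ ≠ 0, with h_i ψ = 0 for all i ∈ {0,1,…,m}; (b) there exist j ∈ {1,…,k} and ψ ∈ H,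 ψ ≠ 0, with Π_j ψ = ψ and h_i^{(j)} ψ = 0 for all i ∈ {0,1,…,m}. -/
/-- If `v` is fixed by `p ∘ q ∘ p` for orthogonal projections `p` and `q`, then it is fixed by
both `p` and `q`. -/
theorem LinearMap.IsSymmetric.fixed_of_comp_comp_fixed {𝕜 E : Type*} [RCLike 𝕜]
    [NormedAddCommGroup E] [InnerProductSpace 𝕜 E] {p q : E →ₗ[𝕜] E}
    (hp : p.IsSymmetric) (hq : q.IsSymmetric) (hpp : ∀ x, p (p x) = p x)
    (hqq : ∀ x, q (q x) = q x) {v : E} (hv : p (q (p v)) = v) : p v = v ∧ q v = v := by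
  have hpv : p v = v := by rw [← hv, hpp]
  refine ⟨hpv, ?_⟩
  rw [hpv] at hv
  have hinner : inner 𝕜 (q v) v = inner 𝕜 v v := by
    calc inner 𝕜 (q v) v = inner 𝕜 (q v) (p v) := by rw [hpv]
      _ = inner 𝕜 (p (q v)) v := (hp _ _).symm
      _ = inner 𝕜 v v := by rw [hv]
  have horth : inner 𝕜 (v - q v) (q v) = 0 := by
    rw [← hq, map_sub, hqq, sub_self, inner_zero_left]
  have hzero : inner 𝕜 (v - q v) (v - q v) = 0 := by
    rw [inner_sub_right, horth, inner_sub_left, hinner, sub_self, sub_zero]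
  exact (sub_eq_zero.mp (inner_self_eq_zero.mp hzero)).symm

/-- The decrease-dimension-and-rounding Lemma 4.5: with pairwise commuting orthogonal
projections `h 0, …, h m`, and a resolution of the identity `P 1, …, P k` by orthogonal
projections commuting with every `h i` except possibly `h 0`, the original family is
frustration-free iff some reduced family (with `h 0` replaced by the projection onto the
1-eigenspace of `P j ∘ h 0 ∘ P j`) is frustration-free. -/
theorem decrease_dimension_and_rounding {H : Type*} [NormedAddCommGroup H]
    [InnerProductSpace ℂ H] [FiniteDimensional ℂ H] {m k : ℕ}
    (h : Fin (m + 1) → H →ₗ[ℂ] H)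
    (hsa : ∀ i, IsSelfAdjoint (h i)) (hproj : ∀ i, h i ∘ₗ h i = h i)
    (hcomm : ∀ i j, h i ∘ₗ h j = h j ∘ₗ h i)
    (P : Fin k → H →ₗ[ℂ] H)
    (hPsa : ∀ j, IsSelfAdjoint (P j)) (hPproj : ∀ j, P j ∘ₗ P j = P j)
    (hPorth : ∀ j j', j ≠ j' → P j ∘ₗ P j' = 0)
    (hPsum : ∑ j, P j = LinearMap.id)
    (hPcomm : ∀ j, ∀ i, i ≠ 0 → P j ∘ₗ h i = h i ∘ₗ P j)
    (g0 : Fin k → H →ₗ[ℂ] H)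
    (hg0sa : ∀ j, IsSelfAdjoint (g0 j)) (hg0proj : ∀ j, g0 j ∘ₗ g0 j = g0 j)
    (hg0fix : ∀ j, ∀ v : H, g0 j v = v ↔ (P j ∘ₗ h 0 ∘ₗ P j) v = v) :
    (∃ ψ : H, ψ ≠ 0 ∧ ∀ i, h i ψ = 0) ↔
      (∃ j : Fin k, ∃ ψ : H, ψ ≠ 0 ∧ P j ψ = ψ ∧ g0 j ψ = 0 ∧
        ∀ i, i ≠ 0 → (P j ∘ₗ h i ∘ₗ P j) ψ = 0) := by
  have hsymm i : (h i).IsSymmetric := (LinearMap.isSymmetric_iff_isSelfAdjoint _).mpr (hsa i)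
  have hPsymm j : (P j).IsSymmetric := (LinearMap.isSymmetric_iff_isSelfAdjoint _).mpr (hPsa j)
  have hgsymm j : (g0 j).IsSymmetric := (LinearMap.isSymmetric_iff_isSelfAdjoint _).mpr (hg0sa j)
  have hidem i x : h i (h i x) = h i x := LinearMap.congr_fun (hproj i) x
  have hPidem j x : P j (P j x) = P j x := LinearMap.congr_fun (hPproj j) x
  have hgidem j x : g0 j (g0 j x) = g0 j x := LinearMap.congr_fun (hg0proj j) x
  have hPh j i (hi : i ≠ 0) x : P j (h i x) = h i (P j x) :=
    LinearMap.congr_fun (hPcomm j i hi) x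
  constructor
  · rintro ⟨ψ, hψ, hker⟩
    obtain ⟨j, hj⟩ : ∃ j, P j ψ ≠ 0 := by
      by_contra! hall
      apply hψ
      simpa [LinearMap.sum_apply, hall] using (LinearMap.congr_fun hPsum ψ).symm
    refine ⟨j, P j ψ, hj, hPidem j ψ, ?_, fun i hi => ?_⟩
    · obtain ⟨hPv, hhv⟩ := (hPsymm j).fixed_of_comp_comp_fixed (hsymm 0) (hPidem j) (hidem 0)
        ((hg0fix j _).mp (hgidem j (P j ψ)))
      rw [← inner_self_eq_zero (𝕜 := ℂ), ← hgsymm, hgidem, ← hPsymm, hPv, ← hhv, hsymm,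
        hker, inner_zero_right]
    · simp [hPidem, ← hPh j i hi, hker]
  · rintro ⟨j, φ, hφ, hPφ, hgφ, hker⟩
    refine ⟨φ - h 0 φ, fun hzero => hφ ?_, fun i => ?_⟩
    · rw [← hgφ]
      refine ((hg0fix j φ).mpr ?_).symm
      simp [hPφ, ← sub_eq_zero.mp hzero]
    · by_cases hi : i = 0
      · rw [hi, map_sub, hidem, sub_self]
      · have hiφ : h i φ = 0 := by
          have := hker i hi
          simpa [hPφ, hPh j i hi] using this
        have hc : h i (h 0 φ) = h 0 (h i φ) := LinearMap.congr_fun (hcomm i 0) φ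
        rw [map_sub, hc, hiφ, map_zero, sub_zero]
end

section
/- Let H be a finite-dimensional complex inner product space, let h_0, h_1, …, h_m be pairwise commuting orthogonal projections on H, and let Π_1, …, Π_k be orthogonal projections on H with Π_j∘Π_{j'} = 0 for j ≠ j', ∑_{j=1}^k Π_j = id_H, and Π_j∘h_i = h_i∘Π_j for every j and every i ∈ {1,…,m}. For each j define h_i^{(j)} := Π_j∘h_i∘Π_j for 1 ≤ i ≤ m, and let h_0^{(j)} be the orthogonal projection onto the 1-eigenspace of Π_j∘h_0∘Π_j. Then: (1) for every j, tr((Π_j − h_0^{(j)})∘(Π_j − h_1^{(j)})∘⋯∘(Π_j − h_m^{(j)})) ≥ 0; and (2) tr((id − h_0)∘(id − h_1)∘⋯∘(id − h_m)) > 0 if and only if there exists j with tr((Π_j − h_0^{(j)})∘(Π_j − h_1^{(j)})∘⋯∘(Π_j − h_m^{(j)})) > 0. -/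
open ComplexOrder

/-- A product of pairwise commuting star projections is a star projection. -/
theorem List.isStarProjection_prod {R : Type*} [Semiring R] [StarRing R] (l : List R)
    (hl : ∀ a ∈ l, IsStarProjection a) (hc : ∀ a ∈ l, ∀ b ∈ l, Commute a b) :
    IsStarProjection l.prod := by
  induction l with
  | nil => simp
  | cons a l ih =>
    rw [List.prod_cons]
    refine (hl a (by simp)).mul (ih (fun b hb => hl b (by simp [hb])) fun b hb c hc' =>
      hc b (by simp [hb]) c (by simp [hc'])) ?_
    exact Commute.list_prod_right _ _ fun b hb => hc a (by simp) b (by simp [hb])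

/-- An idempotent absorbs further copies of itself inside a product of elements commuting
with it. -/
theorem IsIdempotentElem.mul_prod_map_mul {R : Type*} [Monoid R] {p : R}
    (hp : IsIdempotentElem p) (l : List R) (hl : ∀ a ∈ l, Commute p a) :
    p * (l.map (p * ·)).prod = p * l.prod := by
  induction l with
  | nil => simp
  | cons a l ih =>
    have ha : p * a = a * p := hl a (by simp)
    rw [List.map_cons, List.prod_cons, List.prod_cons, ← mul_assoc, ← mul_assoc, hp.eq, ha,
      mul_assoc, ih fun b hb => hl b (by simp [hb]), ← mul_assoc, ← mul_assoc, ← ha]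

theorem IsIdempotentElem.trace_eq_finrank_range {K V : Type*} [Field K] [AddCommGroup V]
    [Module K V] [FiniteDimensional K V] {f : Module.End K V} (hf : IsIdempotentElem f) :
    LinearMap.trace K V f = (Module.finrank K (LinearMap.range f) : K) :=
  (LinearMap.IsProj.mk (fun x => LinearMap.mem_range_self f x) (by
    rintro _ ⟨x, rfl⟩
    exact LinearMap.congr_fun hf.eq x)).trace

theorem IsIdempotentElem.trace_nonneg {V : Type*} [AddCommGroup V] [Module ℂ V]
    [FiniteDimensional ℂ V] {f : Module.End ℂ V} (hf : IsIdempotentElem f) :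
    0 ≤ LinearMap.trace ℂ V f := by
  rw [hf.trace_eq_finrank_range]
  exact Nat.cast_nonneg _

theorem IsIdempotentElem.trace_pos_iff {V : Type*} [AddCommGroup V] [Module ℂ V]
    [FiniteDimensional ℂ V] {f : Module.End ℂ V} (hf : IsIdempotentElem f) :
    0 < LinearMap.trace ℂ V f ↔ f ≠ 0 := by
  rw [hf.trace_eq_finrank_range, Nat.cast_pos, Nat.pos_iff_ne_zero, Ne, Submodule.finrank_eq_zero,
    LinearMap.range_eq_bot]

section StarProjection

variable {H : Type*} [NormedAddCommGroup H] [InnerProductSpace ℂ H] [FiniteDimensional ℂ H]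

/-- The projection onto the fixed space of `M` commutes with every self-adjoint operator
commuting with `M`. -/
theorem IsStarProjection.commute_of_fixed_iff {g M q : Module.End ℂ H}
    (hg : IsStarProjection g) (hfix : ∀ v, g v = v ↔ M v = v) (hq : IsSelfAdjoint q)
    (hqM : Commute q M) : Commute g q := by
  have key : g * q * g = q * g := by
    ext v
    have hgv : M (g v) = g v := (hfix _).1 (LinearMap.congr_fun hg.isIdempotentElem.eq v)
    refine (hfix (q (g v))).2 ?_
    rw [← Module.End.mul_apply, ← hqM.eq, Module.End.mul_apply, hgv]
  have key' := congrArg star key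
  simp only [star_mul, hg.isSelfAdjoint.star_eq, hq.star_eq, ← mul_assoc] at key'
  exact key'.symm.trans key

/-- If compressing a star projection `e` by a self-adjoint `p` fixes a vector fixed by `p`,
then `e` fixes that vector. -/
theorem IsStarProjection.apply_eq_self_of_compression {e p : Module.End ℂ H}
    (he : IsStarProjection e) (hp : IsSelfAdjoint p) {w : H} (hpw : p w = w)
    (hw : p (e w) = w) : e w = w := by
  have hps := (LinearMap.isSymmetric_iff_isSelfAdjoint p).2 hp
  have hes := (LinearMap.isSymmetric_iff_isSelfAdjoint e).2 he.isSelfAdjoint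
  have hee : e (e w) = e w := LinearMap.congr_fun he.isIdempotentElem.eq w
  have h1 : inner ℂ w (w - e w) = 0 := by
    have := hps w (w - e w)
    rwa [map_sub, hpw, hw, sub_self, inner_zero_right] at this
  have h2 : inner ℂ (e w) (w - e w) = 0 := by
    rw [hes w (w - e w), map_sub, hee, sub_self, inner_zero_right]
  have h3 : inner ℂ (w - e w) (w - e w) = 0 := by rw [inner_sub_left, h1, h2, sub_zero]
  exact (sub_eq_zero.1 (inner_self_eq_zero.1 h3)).symm

theorem IsStarProjection.mul_eq_of_fixed_compression {g e p : Module.End ℂ H}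
    (hg : IsStarProjection g) (hp : IsStarProjection p)
    (hfix : ∀ v, g v = v ↔ (p * e * p) v = v) : p * g = g := by
  ext v
  have hgv := (hfix (g v)).1 (LinearMap.congr_fun hg.isIdempotentElem.eq v)
  rw [Module.End.mul_apply, ← hgv, mul_assoc, Module.End.mul_apply, ← Module.End.mul_apply (f := p),
    hp.isIdempotentElem.eq]

end StarProjection

/-- The trace-decomposition chain of Lemma 4.5: each reduced trace
`tr((P j − h₀⁽ʲ⁾)∘⋯∘(P j − h_m⁽ʲ⁾))` is non-negative, and
`tr((id − h₀)∘⋯∘(id − h_m)) > 0` iff some reduced trace is positive. -/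
theorem trace_decomposition_chain {H : Type*} [NormedAddCommGroup H]
    [InnerProductSpace ℂ H] [FiniteDimensional ℂ H] {m k : ℕ}
    (h : Fin (m + 1) → H →ₗ[ℂ] H)
    (hsa : ∀ i, IsSelfAdjoint (h i)) (hproj : ∀ i, h i ∘ₗ h i = h i)
    (hcomm : ∀ i j, h i ∘ₗ h j = h j ∘ₗ h i)
    (P : Fin k → H →ₗ[ℂ] H)
    (hPsa : ∀ j, IsSelfAdjoint (P j)) (hPproj : ∀ j, P j ∘ₗ P j = P j)
    (hPorth : ∀ j j', j ≠ j' → P j ∘ₗ P j' = 0)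
    (hPsum : ∑ j, P j = LinearMap.id)
    (hPcomm : ∀ j, ∀ i, i ≠ 0 → P j ∘ₗ h i = h i ∘ₗ P j)
    (g0 : Fin k → H →ₗ[ℂ] H)
    (hg0sa : ∀ j, IsSelfAdjoint (g0 j)) (hg0proj : ∀ j, g0 j ∘ₗ g0 j = g0 j)
    (hg0fix : ∀ j, ∀ v : H, g0 j v = v ↔ (P j ∘ₗ h 0 ∘ₗ P j) v = v) :
    (∀ j : Fin k, 0 ≤ LinearMap.trace ℂ H
        ((List.ofFn (fun i : Fin (m + 1) =>
          P j - if i = 0 then g0 j else P j ∘ₗ h i ∘ₗ P j)).prod)) ∧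
    ((0 < LinearMap.trace ℂ H
        ((List.ofFn (fun i : Fin (m + 1) => LinearMap.id - h i)).prod)) ↔
      ∃ j : Fin k, 0 < LinearMap.trace ℂ H
        ((List.ofFn (fun i : Fin (m + 1) =>
          P j - if i = 0 then g0 j else P j ∘ₗ h i ∘ₗ P j)).prod)) := by
  have hh (i) : IsStarProjection (h i) := ⟨hproj i, hsa i⟩
  have hP (j) : IsStarProjection (P j) := ⟨hPproj j, hPsa j⟩
  have hg (j) : IsStarProjection (g0 j) := ⟨hg0proj j, hg0sa j⟩
  have hPg (j) : P j * g0 j = g0 j := (hg j).mul_eq_of_fixed_compression (hP j) (hg0fix j)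
  have hgP (j) : g0 j * P j = g0 j := by
    have := congrArg star (hPg j)
    rwa [star_mul, (hg j).isSelfAdjoint.star_eq, (hP j).isSelfAdjoint.star_eq] at this
  let f : Fin m → Module.End ℂ H := fun i => 1 - h i.succ
  set Q : Module.End ℂ H := (List.ofFn f).prod with hQdef
  have hQ : IsStarProjection Q := by
    refine List.isStarProjection_prod _ ?_ ?_ <;> simp only [List.forall_mem_ofFn_iff]
    · exact fun i => (hh i.succ).one_sub
    · exact fun i i' => ((Commute.one_left _).sub_left
        ((Commute.one_right _).sub_right (hcomm i.succ i'.succ)))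
  have hPf (j) : ∀ a ∈ List.ofFn f, Commute (P j) a := by
    simp only [List.forall_mem_ofFn_iff]
    exact fun i => (Commute.one_right _).sub_right (hPcomm j _ i.succ_ne_zero)
  have hPQ (j) : Commute (P j) Q := Commute.list_prod_right _ _ (hPf j)
  have hhQ : Commute (h 0) Q := by
    refine Commute.list_prod_right _ _ ?_
    simp only [List.forall_mem_ofFn_iff]
    exact fun i => (Commute.one_right _).sub_right (hcomm 0 i.succ)
  have hgQ (j) : Commute (g0 j) Q :=
    (hg j).commute_of_fixed_iff (M := P j * (h 0 * P j)) (hg0fix j) hQ.isSelfAdjoint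
      ((hPQ j).symm.mul_right (hhQ.symm.mul_right (hPQ j).symm))
  have hfull : (List.ofFn (fun i : Fin (m + 1) => LinearMap.id - h i)).prod = (1 - h 0) * Q := by
    rw [List.ofFn_succ, List.prod_cons]
    rfl
  have hred (j) : (List.ofFn (fun i : Fin (m + 1) =>
      P j - if i = 0 then g0 j else P j ∘ₗ h i ∘ₗ P j)).prod = (P j - g0 j) * Q := by
    have hfac : (fun i : Fin m => P j - if i.succ = 0 then g0 j else P j ∘ₗ h i.succ ∘ₗ P j) =
        (P j * ·) ∘ f := by
      funext i
      have hc : P j * h i.succ = h i.succ * P j := hPcomm j _ i.succ_ne_zero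
      have hi : P j * P j = P j := hPproj j
      rw [if_neg i.succ_ne_zero]
      change P j - P j * (h i.succ * P j) = P j * (1 - h i.succ)
      rw [← hc, ← mul_assoc, hi, mul_sub, mul_one]
    have habs : P j - g0 j = (P j - g0 j) * P j := by
      rw [sub_mul, hgP, (hP j).isIdempotentElem.eq]
    rw [List.ofFn_succ, List.prod_cons, hfac, if_pos rfl, ← List.map_ofFn, habs, mul_assoc,
      (hP j).isIdempotentElem.mul_prod_map_mul _ (hPf j), mul_assoc]
  have hfullI : IsIdempotentElem ((1 - h 0) * Q) :=
    (hh 0).one_sub.isIdempotentElem.mul_of_commute ((Commute.one_left _).sub_left hhQ)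
      hQ.isIdempotentElem
  have hredI (j) : IsIdempotentElem ((P j - g0 j) * Q) := by
    refine IsIdempotentElem.mul_of_commute ((hPQ j).sub_left (hgQ j)) ?_ hQ.isIdempotentElem
    rw [IsIdempotentElem, mul_sub, sub_mul, sub_mul, hPg, hgP, (hP j).isIdempotentElem.eq,
      (hg j).isIdempotentElem.eq, sub_self, sub_zero]
  simp only [hfull, hred, hfullI.trace_pos_iff, (hredI _).trace_pos_iff]
  refine ⟨fun j => (hredI j).trace_nonneg, ?_⟩
  rw [← not_iff_not]
  push Not
  have hsub (j) : (P j - g0 j) * Q = 0 ↔ g0 j * (P j * Q) = P j * Q := by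
    rw [sub_mul, sub_eq_zero, ← mul_assoc, hgP, eq_comm]
  have hPP (j) (v : H) : P j (P j v) = P j v := LinearMap.congr_fun (hPproj j) v
  simp only [hsub]
  rw [sub_mul, one_mul, sub_eq_zero]
  constructor
  · intro hQh j
    ext v
    refine (hg0fix j (P j (Q v))).2 ?_
    have hcv : P j (Q v) = Q (P j v) := LinearMap.congr_fun (hPQ j).eq v
    have hqv : h 0 (Q (P j v)) = Q (P j v) := (LinearMap.congr_fun hQh (P j v)).symm
    rw [LinearMap.comp_apply, LinearMap.comp_apply, hPP, hcv, hqv, ← hcv, hPP]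
  · intro hall
    have hfixed (j) : h 0 * (P j * Q) = P j * Q := by
      ext v
      have hv := (hg0fix j (P j (Q v))).1 (LinearMap.congr_fun (hall j) v)
      rw [LinearMap.comp_apply, LinearMap.comp_apply, hPP] at hv
      exact (hh 0).apply_eq_self_of_compression (hPsa j) (hPP j _) hv
    have hsumQ : ∑ j, P j * Q = Q := by
      rw [← Finset.sum_mul, hPsum]
      rfl
    rw [← hsumQ, Finset.mul_sum]
    exact (Finset.sum_congr rfl fun j _ => hfixed j).symm
end

section
/- Let H be a finite-dimensional complex inner product space, let ĥ be a nonzero self-adjoint operator on H, and let (h_i)_{i ∈ I} be a finite family of self-adjoint operators on H such that for every i, either ĥ∘h_i = h_i∘ĥ or ĥ∘h_i = −(h_i∘ĥ). Suppose there exists i₀ ∈ I with h_{i₀} ≠ 0 and ĥ∘h_{i₀} = 0. Then the subspace K := ker ĥ satisfies K ≠ {0} and K ≠ H, and every operator in {ĥ} ∪ {h_i : i ∈ I} maps K into K and maps the orthogonal complement K^⊥ into K^⊥. -/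
/-- The orthogonal complement of a subspace invariant under a symmetric operator is invariant. -/
theorem LinearMap.IsSymmetric.map_mem_orthogonal {𝕜 E : Type*} [RCLike 𝕜]
    [NormedAddCommGroup E] [InnerProductSpace 𝕜 E] {T : E →ₗ[𝕜] E} (hT : T.IsSymmetric)
    {K : Submodule 𝕜 E} (hK : ∀ x ∈ K, T x ∈ K) {x : E} (hx : x ∈ Kᗮ) : T x ∈ Kᗮ := by
  intro y hy
  rw [← hT y x]
  exact hx (T y) (hK y hy)

/-- The kernel of an operator is invariant under every operator commuting or anticommuting
with it. -/
theorem LinearMap.map_mem_ker_of_comp_eq_or_eq_neg {R M : Type*} [Ring R] [AddCommGroup M]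
    [Module R M] {S T : M →ₗ[R] M} (hST : S ∘ₗ T = T ∘ₗ S ∨ S ∘ₗ T = -(T ∘ₗ S)) {x : M}
    (hx : x ∈ LinearMap.ker S) : T x ∈ LinearMap.ker S := by
  rw [LinearMap.mem_ker] at hx ⊢
  rcases hST with hST | hST <;> simpa [hx] using LinearMap.congr_fun hST x

/-- Lemma 5.2: if a nonzero self-adjoint `ĥ` commutes or anticommutes with each member of
a finite family of self-adjoint operators, one of which is nonzero and annihilated by
`ĥ`, then `K = ker ĥ` is a non-trivial proper subspace and all the operators preserve
both `K` and its orthogonal complement. -/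
theorem separable_from_annihilating_factor {H : Type*} [NormedAddCommGroup H]
    [InnerProductSpace ℂ H] [FiniteDimensional ℂ H]
    (hhat : H →ₗ[ℂ] H) (hhatsa : IsSelfAdjoint hhat) (hhatne : hhat ≠ 0)
    {I : Type*} [Fintype I] (h : I → H →ₗ[ℂ] H)
    (hsa : ∀ i, IsSelfAdjoint (h i))
    (hcm : ∀ i, hhat ∘ₗ h i = h i ∘ₗ hhat ∨ hhat ∘ₗ h i = -(h i ∘ₗ hhat))
    (i₀ : I) (h0ne : h i₀ ≠ 0) (h0z : hhat ∘ₗ h i₀ = 0) :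
    LinearMap.ker hhat ≠ ⊥ ∧ LinearMap.ker hhat ≠ ⊤ ∧
    (∀ ψ ∈ LinearMap.ker hhat, hhat ψ ∈ LinearMap.ker hhat ∧
      ∀ i, h i ψ ∈ LinearMap.ker hhat) ∧
    (∀ ψ ∈ (LinearMap.ker hhat)ᗮ, hhat ψ ∈ (LinearMap.ker hhat)ᗮ ∧
      ∀ i, h i ψ ∈ (LinearMap.ker hhat)ᗮ) := by
  have hK : ∀ ψ ∈ LinearMap.ker hhat, hhat ψ ∈ LinearMap.ker hhat := fun ψ hψ =>
    LinearMap.map_mem_ker_of_comp_eq_or_eq_neg (Or.inl rfl) hψ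
  have hKi : ∀ i, ∀ ψ ∈ LinearMap.ker hhat, h i ψ ∈ LinearMap.ker hhat := fun i ψ hψ =>
    LinearMap.map_mem_ker_of_comp_eq_or_eq_neg (hcm i) hψ
  refine ⟨fun hbot => h0ne ?_, fun htop => hhatne (LinearMap.ker_eq_top.mp htop),
    fun ψ hψ => ⟨hK ψ hψ, fun i => hKi i ψ hψ⟩, fun ψ hψ => ⟨?_, fun i => ?_⟩⟩
  · ext ψ
    exact LinearMap.ker_eq_bot'.mp hbot _ (LinearMap.congr_fun h0z ψ)
  · exact (LinearMap.isSymmetric_iff_isSelfAdjoint hhat).mpr hhatsa |>.map_mem_orthogonal hK hψ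
  · exact (LinearMap.isSymmetric_iff_isSelfAdjoint (h i)).mpr (hsa i)
      |>.map_mem_orthogonal (hKi i) hψ
end

section
/- Let a ∈ Matrix (Fin d1) (Fin d1) ℂ, m, m' ∈ Matrix (Fin d2) (Fin d2) ℂ, and b ∈ Matrix (Fin d3) (Fin d3) ℂ be Hermitian matrices with a ≠ 0 and b ≠ 0. Define h := a ⊗ₖ m ⊗ₖ 1_{d3} and ĥ := 1_{d1} ⊗ₖ m' ⊗ₖ b. If h*ĥ = ĥ*h, then m*m' = m'*m. -/
open Kronecker

/-- One-shared-qudit case of Lemma 5.3: two commuting factorized Hermitian terms that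
overlap on a single tensor factor have commuting factors on that factor. -/
theorem factorized_commute_one_shared_qudit {d1 d2 d3 : ℕ}
    (a : Matrix (Fin d1) (Fin d1) ℂ) (m m' : Matrix (Fin d2) (Fin d2) ℂ)
    (b : Matrix (Fin d3) (Fin d3) ℂ)
    (ha : a.IsHermitian) (hm : m.IsHermitian) (hm' : m'.IsHermitian) (hb : b.IsHermitian)
    (hane : a ≠ 0) (hbne : b ≠ 0)
    (hcomm : (a ⊗ₖ m ⊗ₖ (1 : Matrix (Fin d3) (Fin d3) ℂ)) *
               ((1 : Matrix (Fin d1) (Fin d1) ℂ) ⊗ₖ m' ⊗ₖ b)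
           = ((1 : Matrix (Fin d1) (Fin d1) ℂ) ⊗ₖ m' ⊗ₖ b) *
               (a ⊗ₖ m ⊗ₖ (1 : Matrix (Fin d3) (Fin d3) ℂ))) :
    m * m' = m' * m := by
  simp only [← Matrix.mul_kronecker_mul, Matrix.one_mul, Matrix.mul_one] at hcomm
  obtain ⟨i, j, hij⟩ : ∃ i j, a i j ≠ 0 := by
    by_contra! h
    exact hane (Matrix.ext h)
  obtain ⟨k, l, hkl⟩ : ∃ k l, b k l ≠ 0 := by
    by_contra! h
    exact hbne (Matrix.ext h)
  ext p q
  have h := congrFun (congrFun hcomm ((i, p), k)) ((j, q), l)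
  simp only [Matrix.kroneckerMap_apply] at h
  exact mul_left_cancel₀ hij (mul_right_cancel₀ hkl h)
end

section
/- Let a ∈ Matrix (Fin d0) (Fin d0) ℂ, m1, m1' ∈ Matrix (Fin d1) (Fin d1) ℂ, m2, m2' ∈ Matrix (Fin d2) (Fin d2) ℂ, and b ∈ Matrix (Fin d3) (Fin d3) ℂ be Hermitian matrices with a ≠ 0 and b ≠ 0. Define h := a ⊗ₖ m1 ⊗ₖ m2 ⊗ₖ 1_{d3} and ĥ := 1_{d0} ⊗ₖ m1' ⊗ₖ m2' ⊗ₖ b, and suppose h*ĥ = ĥ*h. Then exactly one of the following holds: (1) h*ĥ ≠ 0, and in this case (m1*m1' = m1'*m1 or m1*m1' = −(m1'*m1)) and (m2*m2' = m2'*m2 or m2*m2' = −(m2'*m2)); or (2) h*ĥ = 0, and in this case m1*m1' = 0 or m2*m2' = 0. -/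
open Kronecker

namespace Matrix

section Kronecker

variable {l m n p R : Type*}

theorem kronecker_eq_zero_iff [MulZeroClass R] [NoZeroDivisors R]
    {A : Matrix l m R} {B : Matrix n p R} : A ⊗ₖ B = 0 ↔ A = 0 ∨ B = 0 := by
  refine ⟨fun h => ?_, ?_⟩
  · by_contra! hAB
    obtain ⟨i, j, hij⟩ : ∃ i j, A i j ≠ 0 := by
      by_contra! h0
      exact hAB.1 (Matrix.ext h0)
    refine hAB.2 (Matrix.ext fun k q => ?_)
    exact (mul_eq_zero.mp (congrFun₂ h (i, k) (j, q))).resolve_left hij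
  · rintro (rfl | rfl)
    exacts [zero_kronecker B, kronecker_zero A]

theorem kronecker_left_cancel [Ring R] [NoZeroDivisors R] {A : Matrix l m R}
    {B B' : Matrix n p R} (hA : A ≠ 0) (h : A ⊗ₖ B = A ⊗ₖ B') : B = B' := by
  have h0 : A ⊗ₖ (B - B') = 0 := by
    rw [sub_eq_add_neg, kronecker_add, h, ← kronecker_add, add_neg_cancel, kronecker_zero]
  exact sub_eq_zero.mp ((kronecker_eq_zero_iff.mp h0).resolve_left hA)

theorem kronecker_right_cancel [Ring R] [NoZeroDivisors R] {A A' : Matrix l m R}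
    {B : Matrix n p R} (hB : B ≠ 0) (h : A ⊗ₖ B = A' ⊗ₖ B) : A = A' := by
  have h0 : (A - A') ⊗ₖ B = 0 := by
    rw [sub_eq_add_neg, add_kronecker, h, ← add_kronecker, add_neg_cancel, zero_kronecker]
  exact sub_eq_zero.mp ((kronecker_eq_zero_iff.mp h0).resolve_right hB)

theorem exists_eq_smul_left_of_kronecker_eq [Field R] {A A' : Matrix l m R}
    {B B' : Matrix n p R} (hB : B ≠ 0) (h : A ⊗ₖ B = A' ⊗ₖ B') : ∃ c : R, A = c • A' := by
  obtain ⟨k, q, hkq⟩ : ∃ k q, B k q ≠ 0 := by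
    by_contra! h0
    exact hB (Matrix.ext h0)
  refine ⟨B' k q / B k q, Matrix.ext fun i j => ?_⟩
  have hij : A i j * B k q = A' i j * B' k q := congrFun₂ h (i, k) (j, q)
  rw [smul_apply, smul_eq_mul]
  field_simp
  linear_combination hij

theorem exists_eq_smul_right_of_kronecker_eq [Field R] {A A' : Matrix l m R}
    {B B' : Matrix n p R} (hA : A ≠ 0) (h : A ⊗ₖ B = A' ⊗ₖ B') : ∃ c : R, B = c • B' := by
  refine exists_eq_smul_left_of_kronecker_eq (B' := A') hA (Matrix.ext fun i j => ?_)
  simpa [mul_comm] using congrFun₂ h i.swap j.swap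

end Kronecker

open scoped ComplexOrder in
/-- Hermitian matrices that commute up to a scalar commute up to sign. -/
theorem IsHermitian.commute_or_anticommute_of_mul_eq_smul {n : Type*} [Fintype n]
    {A B : Matrix n n ℂ} (hA : A.IsHermitian) (hB : B.IsHermitian) {c : ℂ}
    (h : A * B = c • (B * A)) : A * B = B * A ∨ A * B = -(B * A) := by
  have hH : (A * B)ᴴ = B * A := by rw [conjTranspose_mul, hA.eq, hB.eq]
  by_cases h0 : A * B = 0
  · left
    rw [← hH, h0, conjTranspose_zero]
  have hmul : A * (A * B) * B = (c * c) • ((A * B)ᴴ * (A * B)) := by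
    calc A * (A * B) * B = A * (c • (B * A)) * B := by rw [← h]
      _ = c • (A * B * (A * B)) := by
          simp only [Matrix.mul_smul, Matrix.smul_mul, Matrix.mul_assoc]
      _ = c • ((c • (B * A)) * (A * B)) := by rw [← h]
      _ = (c * c) • ((A * B)ᴴ * (A * B)) := by rw [hH, Matrix.smul_mul, smul_smul]
  have htr : (A * (A * B) * B).trace = ((A * B)ᴴ * (A * B)).trace := by
    rw [trace_mul_comm, hH, Matrix.mul_assoc]
  have hne : ((A * B)ᴴ * (A * B)).trace ≠ 0 := by
    rwa [Ne, trace_conjTranspose_mul_self_eq_zero_iff]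
  rw [hmul, trace_smul, smul_eq_mul] at htr
  have hc : c * c = 1 := mul_right_cancel₀ hne (by rw [htr, one_mul])
  rcases mul_self_eq_one_iff.mp hc with rfl | rfl
  · left; simpa using h
  · right; simpa using h

end Matrix

/-- Two-shared-qudit case of Lemma 5.3 (Lemma 9 of Bravyi–Vyalyi): two commuting
factorized Hermitian terms overlapping on two tensor factors either have a nonzero
product and factors commuting up to sign on both shared factors, or have product zero
and a vanishing factor product on one of the shared factors. -/
theorem factorized_commute_two_shared_qudits {d0 d1 d2 d3 : ℕ}
    (a : Matrix (Fin d0) (Fin d0) ℂ)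
    (m1 m1' : Matrix (Fin d1) (Fin d1) ℂ) (m2 m2' : Matrix (Fin d2) (Fin d2) ℂ)
    (b : Matrix (Fin d3) (Fin d3) ℂ)
    (ha : a.IsHermitian) (hm1 : m1.IsHermitian) (hm1' : m1'.IsHermitian)
    (hm2 : m2.IsHermitian) (hm2' : m2'.IsHermitian) (hb : b.IsHermitian)
    (hane : a ≠ 0) (hbne : b ≠ 0)
    (hcomm : (a ⊗ₖ m1 ⊗ₖ m2 ⊗ₖ (1 : Matrix (Fin d3) (Fin d3) ℂ)) *
               ((1 : Matrix (Fin d0) (Fin d0) ℂ) ⊗ₖ m1' ⊗ₖ m2' ⊗ₖ b)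
           = ((1 : Matrix (Fin d0) (Fin d0) ℂ) ⊗ₖ m1' ⊗ₖ m2' ⊗ₖ b) *
               (a ⊗ₖ m1 ⊗ₖ m2 ⊗ₖ (1 : Matrix (Fin d3) (Fin d3) ℂ))) :
    ((a ⊗ₖ m1 ⊗ₖ m2 ⊗ₖ (1 : Matrix (Fin d3) (Fin d3) ℂ)) *
        ((1 : Matrix (Fin d0) (Fin d0) ℂ) ⊗ₖ m1' ⊗ₖ m2' ⊗ₖ b) ≠ 0 ∧
      (m1 * m1' = m1' * m1 ∨ m1 * m1' = -(m1' * m1)) ∧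
      (m2 * m2' = m2' * m2 ∨ m2 * m2' = -(m2' * m2))) ∨
    ((a ⊗ₖ m1 ⊗ₖ m2 ⊗ₖ (1 : Matrix (Fin d3) (Fin d3) ℂ)) *
        ((1 : Matrix (Fin d0) (Fin d0) ℂ) ⊗ₖ m1' ⊗ₖ m2' ⊗ₖ b) = 0 ∧
      (m1 * m1' = 0 ∨ m2 * m2' = 0)) := by
  simp only [← Matrix.mul_kronecker_mul, Matrix.mul_one, Matrix.one_mul] at hcomm ⊢
  have hab := Matrix.kronecker_right_cancel hbne hcomm
  have hzero : a ⊗ₖ (m1 * m1') ⊗ₖ (m2 * m2') ⊗ₖ b = 0 ↔ m1 * m1' = 0 ∨ m2 * m2' = 0 := by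
    simp [Matrix.kronecker_eq_zero_iff, hane, hbne]
  by_cases h0 : m1 * m1' = 0 ∨ m2 * m2' = 0
  · exact Or.inr ⟨hzero.mpr h0, h0⟩
  refine Or.inl ⟨mt hzero.mp h0, ?_, ?_⟩
  · obtain ⟨c, hc⟩ := Matrix.exists_eq_smul_left_of_kronecker_eq (fun h => h0 (Or.inr h)) hab
    rw [← Matrix.kronecker_smul] at hc
    exact hm1.commute_or_anticommute_of_mul_eq_smul hm1' (Matrix.kronecker_left_cancel hane hc)
  · have hne : a ⊗ₖ (m1 * m1') ≠ 0 := fun h =>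
      h0 (Or.inl ((Matrix.kronecker_eq_zero_iff.mp h).resolve_left hane))
    obtain ⟨c, hc⟩ := Matrix.exists_eq_smul_right_of_kronecker_eq hne hab
    exact hm2.commute_or_anticommute_of_mul_eq_smul hm2' hc
end

section
/- Let a ∈ Matrix (Fin d0) (Fin d0) ℂ, m1, m1' ∈ Matrix (Fin d1) (Fin d1) ℂ, m2, m2' ∈ Matrix (Fin d2) (Fin d2) ℂ, and b ∈ Matrix (Fin d3) (Fin d3) ℂ be Hermitian matrices with a ≠ 0 and b ≠ 0. Define h := a ⊗ₖ m1 ⊗ₖ m2 ⊗ₖ 1_{d3} and ĥ := 1_{d0} ⊗ₖ m1' ⊗ₖ m2' ⊗ₖ b, and suppose h*ĥ = ĥ*h. If h and ĥ commute in a singular way, i.e. ¬(m1*m1' = m1'*m1 ∨ m1*m1' = −(m1'*m1)) or ¬(m2*m2' = m2'*m2 ∨ m2*m2' = −(m2'*m2)), then either m1*m1' = 0 and ¬(m2*m2' = m2'*m2 ∨ m2*m2' = −(m2'*m2)), or m2*m2' = 0 and ¬(m1*m1' = m1'*m1 ∨ m1*m1' = −(m1'*m1)). -/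
open Kronecker

/-- If the product `A * B` of two Hermitian matrices is a nonzero multiple of `B * A`, then
`A` and `B` commute or anticommute: the factor is real, by comparing traces, and it has
square one. -/
theorem Matrix.IsHermitian.commute_or_anticommute_of_mul_eq_smul_s14 {n : Type*} [Fintype n]
    {A B : Matrix n n ℂ} (hA : A.IsHermitian) (hB : B.IsHermitian) (hAB : A * B ≠ 0)
    {t : ℂ} (h : A * B = t • (B * A)) : A * B = B * A ∨ A * B = -(B * A) := by
  have hct : (A * B).conjTranspose = B * A := by
    rw [Matrix.conjTranspose_mul, hA.eq, hB.eq]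
  have hct' : (B * A).conjTranspose = A * B := by
    rw [Matrix.conjTranspose_mul, hA.eq, hB.eq]
  have hBA : B * A = star t • (A * B) := by
    rw [← hct', ← Matrix.conjTranspose_smul, ← h, hct]
  have htr : (B * A * (A * B)).trace ≠ 0 := by
    rw [← hct]
    open scoped ComplexOrder in
    exact fun h0 => hAB (Matrix.trace_conjTranspose_mul_self_eq_zero_iff.mp h0)
  have h1 : (A * B * (A * B)).trace = t * (B * A * (A * B)).trace := by
    nth_rewrite 1 [h]
    rw [Matrix.smul_mul, Matrix.trace_smul, smul_eq_mul]
  have h2 : (B * A * (B * A)).trace = star t * (B * A * (A * B)).trace := by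
    nth_rewrite 2 [hBA]
    rw [Matrix.mul_smul, Matrix.trace_smul, smul_eq_mul]
  have h3 : (A * B * (A * B)).trace = (B * A * (B * A)).trace := by
    rw [Matrix.mul_assoc, Matrix.trace_mul_comm A]
    simp only [Matrix.mul_assoc]
  have ht : star t = t := mul_right_cancel₀ htr (by rw [← h1, ← h2, h3])
  have hsq : t * t = 1 := by
    have h4 : (t * t) • (A * B) = (1 : ℂ) • (A * B) := by
      rw [one_smul, mul_smul]
      nth_rewrite 2 [← ht]
      rw [← hBA, ← h]
    exact smul_left_injective ℂ hAB h4
  rcases mul_self_eq_one_iff.mp hsq with rfl | rfl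
  · left; rw [h, one_smul]
  · right; rw [h, neg_one_smul]

/-- If `P ⊗ R = Q ⊗ S` entrywise and `R ≠ 0`, then `P` is a scalar multiple of `Q`. -/
theorem Matrix.exists_eq_smul_of_entry_mul_eq {m n p q K : Type*} [Field K]
    {P Q : Matrix m n K} {R S : Matrix p q K}
    (h : ∀ i j k l, P i j * R k l = Q i j * S k l) (hR : R ≠ 0) : ∃ t : K, P = t • Q := by
  obtain ⟨k, l, hkl⟩ : ∃ k l, R k l ≠ 0 := by
    by_contra! h0
    exact hR (Matrix.ext h0)
  refine ⟨S k l / R k l, Matrix.ext fun i j => ?_⟩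
  rw [Matrix.smul_apply, smul_eq_mul, div_mul_eq_mul_div, eq_div_iff hkl, h i j k l, mul_comm]

/-- Corollary 5.5: if two commuting factorized Hermitian terms sharing two tensor
factors commute in a singular way (on some shared factor the factors neither commute
nor anticommute), then on one shared factor the factor product vanishes and on the
other the factors neither commute nor anticommute. -/
theorem singular_commuting_two_shared_qudits {d0 d1 d2 d3 : ℕ}
    (a : Matrix (Fin d0) (Fin d0) ℂ)
    (m1 m1' : Matrix (Fin d1) (Fin d1) ℂ) (m2 m2' : Matrix (Fin d2) (Fin d2) ℂ)
    (b : Matrix (Fin d3) (Fin d3) ℂ)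
    (ha : a.IsHermitian) (hm1 : m1.IsHermitian) (hm1' : m1'.IsHermitian)
    (hm2 : m2.IsHermitian) (hm2' : m2'.IsHermitian) (hb : b.IsHermitian)
    (hane : a ≠ 0) (hbne : b ≠ 0)
    (hcomm : (a ⊗ₖ m1 ⊗ₖ m2 ⊗ₖ (1 : Matrix (Fin d3) (Fin d3) ℂ)) *
               ((1 : Matrix (Fin d0) (Fin d0) ℂ) ⊗ₖ m1' ⊗ₖ m2' ⊗ₖ b)
           = ((1 : Matrix (Fin d0) (Fin d0) ℂ) ⊗ₖ m1' ⊗ₖ m2' ⊗ₖ b) *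
               (a ⊗ₖ m1 ⊗ₖ m2 ⊗ₖ (1 : Matrix (Fin d3) (Fin d3) ℂ)))
    (hsing : ¬(m1 * m1' = m1' * m1 ∨ m1 * m1' = -(m1' * m1)) ∨
             ¬(m2 * m2' = m2' * m2 ∨ m2 * m2' = -(m2' * m2))) :
    (m1 * m1' = 0 ∧ ¬(m2 * m2' = m2' * m2 ∨ m2 * m2' = -(m2' * m2))) ∨
    (m2 * m2' = 0 ∧ ¬(m1 * m1' = m1' * m1 ∨ m1 * m1' = -(m1' * m1))) := by
  obtain ⟨i₀, j₀, ha₀⟩ : ∃ i j, a i j ≠ 0 := by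
    by_contra! h0
    exact hane (Matrix.ext h0)
  obtain ⟨i₃, j₃, hb₃⟩ : ∃ i j, b i j ≠ 0 := by
    by_contra! h0
    exact hbne (Matrix.ext h0)
  simp only [← Matrix.mul_kronecker_mul, Matrix.one_mul, Matrix.mul_one] at hcomm
  have key : ∀ i j k l, (m1 * m1') i j * (m2 * m2') k l = (m1' * m1) i j * (m2' * m2) k l := by
    intro i j k l
    have h := congrFun (congrFun hcomm (((i₀, i), k), i₃)) (((j₀, j), l), j₃)
    simp only [Matrix.kronecker_apply] at h
    have h' := mul_right_cancel₀ hb₃ h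
    rw [mul_assoc, mul_assoc] at h'
    exact mul_left_cancel₀ ha₀ h'
  by_cases h1 : m1 * m1' = 0
  · have h1' : m1' * m1 = 0 := by
      rw [← hm1.eq, ← hm1'.eq, ← Matrix.conjTranspose_mul, h1, Matrix.conjTranspose_zero]
    exact Or.inl ⟨h1, hsing.resolve_left fun hn => hn (Or.inl (h1.trans h1'.symm))⟩
  by_cases h2 : m2 * m2' = 0
  · have h2' : m2' * m2 = 0 := by
      rw [← hm2.eq, ← hm2'.eq, ← Matrix.conjTranspose_mul, h2, Matrix.conjTranspose_zero]
    exact Or.inr ⟨h2, hsing.resolve_right fun hn => hn (Or.inl (h2.trans h2'.symm))⟩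
  obtain ⟨t, ht⟩ := Matrix.exists_eq_smul_of_entry_mul_eq key h2
  obtain ⟨s, hs⟩ := Matrix.exists_eq_smul_of_entry_mul_eq (Q := m2' * m2) (S := m1' * m1)
    (fun k l i j => by rw [mul_comm, key i j k l, mul_comm]) h1
  rcases hsing with hn | hn
  · exact absurd (hm1.commute_or_anticommute_of_mul_eq_smul_s14 hm1' h1 ht) hn
  · exact absurd (hm2.commute_or_anticommute_of_mul_eq_smul_s14 hm2' h2 hs) hn
end

section
/- Let d, r ≥ 1 and let G_1, …, G_r ∈ Matrix (Fin d) (Fin d) ℂ be Hermitian matrices such that G_a*G_a = 1_d for every a, for all a, b either G_a*G_b = G_b*G_a or G_a*G_b = −(G_b*G_a), and the subalgebra of Matrix (Fin d) (Fin d) ℂ generated by {G_1, …, G_r} is all of Matrix (Fin d) (Fin d) ℂ. Then there exist n ∈ ℕ with d = 2^n, a unitary matrix U ∈ Matrix (Fin d) (Fin d) ℂ, and a bijection e : Fin d ≃ (Fin n → Fin 2), such that for every a ∈ {1,…,r} there exist a sign ε_a ∈ {1, −1} and matrices σ_{a,1}, …, σ_{a,n}, each belonging to the set {1₂, X, Y,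 Z} where X = [[0,1],[1,0]], Y = [[0,−i],[i,0]], Z = [[1,0],[0,−1]], with (U * G_a * Uᴴ)_{x,y} = ε_a · ∏_{k=1}^{n} (σ_{a,k})_{e(x)(k), e(y)(k)} for all x, y ∈ Fin d. -/
open Matrix

open scoped Kronecker

/-- The four Pauli matrices, the identity included. -/
def IsPauli (σ : Matrix (Fin 2) (Fin 2) ℂ) : Prop :=
  σ = 1 ∨ σ = !![0, 1; 1, 0] ∨ σ = !![0, -Complex.I; Complex.I, 0] ∨ σ = !![1, 0; 0, -1]

namespace IsPauli

variable {σ τ : Matrix (Fin 2) (Fin 2) ℂ}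

lemma isHermitian (h : IsPauli σ) : σ.IsHermitian := by
  rcases h with rfl | rfl | rfl | rfl <;> ext i j <;> fin_cases i <;> fin_cases j <;> simp

lemma mul_self (h : IsPauli σ) : σ * σ = 1 := by
  rcases h with rfl | rfl | rfl | rfl <;> ext i j <;> fin_cases i <;> fin_cases j <;> simp

lemma ne_zero (h : IsPauli σ) : σ ≠ 0 := by
  rintro rfl
  simpa using h.mul_self

lemma mul_ne_zero (hσ : IsPauli σ) (hτ : IsPauli τ) : σ * τ ≠ 0 := by
  intro h
  apply hτ.ne_zero
  rw [← one_mul τ, ← hσ.mul_self, mul_assoc, h, mul_zero]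

lemma commute_or_anticommute (hσ : IsPauli σ) (hτ : IsPauli τ) :
    σ * τ = τ * σ ∨ σ * τ = -(τ * σ) := by
  rcases hσ with rfl | rfl | rfl | rfl <;> rcases hτ with rfl | rfl | rfl | rfl <;>
    simp [Matrix.one_fin_two]

end IsPauli

/-- Hermitian involutions, pairwise commuting or anticommuting, with only scalars in their
commutant. -/
structure IsIrreduciblePauliFamily {ι m : Type*} [Fintype m] [DecidableEq m]
    (G : ι → Matrix m m ℂ) : Prop where
  isHermitian : ∀ a, (G a).IsHermitian
  mul_self : ∀ a, G a * G a = 1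
  commute_or_anticommute : ∀ a b, G a * G b = G b * G a ∨ G a * G b = -(G b * G a)
  commutant : ∀ T : Matrix m m ℂ, (∀ a, T * G a = G a * T) → ∃ c : ℂ, T = c • 1

section Kronecker

variable {m n : Type*}

lemma kronecker_right_injective {σ : Matrix n n ℂ} (hσ : σ ≠ 0) :
    Function.Injective fun A : Matrix m m ℂ => σ ⊗ₖ A := by
  intro A B h
  obtain ⟨i, j, hij⟩ : ∃ i j, σ i j ≠ 0 := by
    by_contra! h0
    exact hσ (Matrix.ext h0)
  ext a b
  simpa [hij] using congrFun₂ h (i, a) (j, b)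

lemma kronecker_neg_right (σ : Matrix n n ℂ) (A : Matrix m m ℂ) :
    σ ⊗ₖ (-A) = -(σ ⊗ₖ A) := by
  ext; simp

lemma kronecker_neg_left (σ : Matrix n n ℂ) (A : Matrix m m ℂ) :
    (-σ) ⊗ₖ A = -(σ ⊗ₖ A) := by
  ext; simp

variable [Fintype m] [DecidableEq m]

/-- A matrix that commutes or anticommutes with `Z ⊗ 1` and with `X ⊗ 1` splits off a Pauli
matrix in the first tensor factor. -/
lemma exists_eq_pauli_kronecker (M : Matrix (Fin 2 × m) (Fin 2 × m) ℂ)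
    (hZ : M * (!![1, 0; 0, -1] ⊗ₖ 1) = (!![1, 0; 0, -1] ⊗ₖ 1) * M ∨
      M * (!![1, 0; 0, -1] ⊗ₖ 1) = -((!![1, 0; 0, -1] ⊗ₖ 1) * M))
    (hX : M * (!![0, 1; 1, 0] ⊗ₖ 1) = (!![0, 1; 1, 0] ⊗ₖ 1) * M ∨
      M * (!![0, 1; 1, 0] ⊗ₖ 1) = -((!![0, 1; 1, 0] ⊗ₖ 1) * M)) :
    ∃ (σ : Matrix (Fin 2) (Fin 2) ℂ) (H : Matrix m m ℂ), IsPauli σ ∧ M = σ ⊗ₖ H := by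
  have right (τ : Matrix (Fin 2) (Fin 2) ℂ) (i j a b) :
      (M * (τ ⊗ₖ (1 : Matrix m m ℂ))) (i, a) (j, b) = ∑ l, M (i, a) (l, b) * τ l j := by
    simp [Matrix.mul_apply, Fintype.sum_prod_type, Matrix.one_apply]
  have left (τ : Matrix (Fin 2) (Fin 2) ℂ) (i j a b) :
      ((τ ⊗ₖ (1 : Matrix m m ℂ)) * M) (i, a) (j, b) = ∑ l, τ i l * M (l, a) (j, b) := by
    simp [Matrix.mul_apply, Fintype.sum_prod_type, Matrix.one_apply]
  have hZ' : (∀ a b, M (0, a) (1, b) = 0 ∧ M (1, a) (0, b) = 0) ∨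
      ∀ a b, M (0, a) (0, b) = 0 ∧ M (1, a) (1, b) = 0 := by
    refine hZ.imp (fun h a b => ?_) fun h a b => ?_
    · have h₁ := congrFun₂ h (0, a) (1, b)
      have h₂ := congrFun₂ h (1, a) (0, b)
      simp only [right, left, Fin.sum_univ_two] at h₁ h₂
      simp at h₁ h₂
      grind
    · have h₁ := congrFun₂ h (0, a) (0, b)
      have h₂ := congrFun₂ h (1, a) (1, b)
      simp only [Matrix.neg_apply, right, left, Fin.sum_univ_two] at h₁ h₂
      simp at h₁ h₂
      grind
  have hX' : (∀ a b, M (1, a) (0, b) = M (0, a) (1, b) ∧ M (1, a) (1, b) = M (0, a) (0, b)) ∨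
      ∀ a b, M (1, a) (0, b) = -M (0, a) (1, b) ∧ M (1, a) (1, b) = -M (0, a) (0, b) := by
    refine hX.imp (fun h a b => ?_) fun h a b => ?_
    all_goals
      have h₁ := congrFun₂ h (0, a) (0, b)
      have h₂ := congrFun₂ h (0, a) (1, b)
      simp only [Matrix.neg_apply, right, left, Fin.sum_univ_two] at h₁ h₂
      simp at h₁ h₂
      grind
  rcases hZ' with hZ | hZ <;> rcases hX' with hX | hX
  · refine ⟨1, Matrix.of fun a b => M (0, a) (0, b), Or.inl rfl, ?_⟩
    ext ⟨i, a⟩ ⟨j, b⟩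
    fin_cases i <;> fin_cases j <;> simp [hZ, hX]
  · refine ⟨_, Matrix.of fun a b => M (0, a) (0, b), Or.inr (Or.inr (Or.inr rfl)), ?_⟩
    ext ⟨i, a⟩ ⟨j, b⟩
    fin_cases i <;> fin_cases j <;> simp [hZ, hX]
  · refine ⟨_, Matrix.of fun a b => M (0, a) (1, b), Or.inr (Or.inl rfl), ?_⟩
    ext ⟨i, a⟩ ⟨j, b⟩
    fin_cases i <;> fin_cases j <;> simp [hZ, hX]
  · refine ⟨_, Matrix.of fun a b => Complex.I * M (0, a) (1, b),
      Or.inr (Or.inr (Or.inl rfl)), ?_⟩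
    ext ⟨i, a⟩ ⟨j, b⟩
    fin_cases i <;> fin_cases j <;> simp [hZ, hX, ← mul_assoc]

end Kronecker

section BlockRows

variable {m k : Type*}

/-- The matrix with block rows `C 0` and `C 1`. -/
def blockRows (C : Fin 2 → Matrix k m ℂ) : Matrix (Fin 2 × k) m ℂ :=
  Matrix.of fun p j => C p.1 p.2 j

lemma blockRows_mul_mul_conjTranspose_apply [Fintype m] (C : Fin 2 → Matrix k m ℂ)
    (A : Matrix m m ℂ) (p q : Fin 2 × k) :
    (blockRows C * A * (blockRows C)ᴴ) p q = (C p.1 * A * (C q.1)ᴴ) p.2 q.2 := rfl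

lemma conjTranspose_blockRows_mul [Fintype k] (C : Fin 2 → Matrix k m ℂ) :
    (blockRows C)ᴴ * blockRows C = (C 0)ᴴ * C 0 + (C 1)ᴴ * C 1 := by
  ext i j
  simp [Matrix.mul_apply, blockRows, Fintype.sum_prod_type]

end BlockRows

/-- The `1`-eigenspace of a Hermitian involution is the range of an isometry. -/
lemma exists_isometry_of_involution {m : Type} [Fintype m] [DecidableEq m] {Z : Matrix m m ℂ}
    (hZ : Z.IsHermitian) (hsq : Z * Z = 1) :
    ∃ (k : Type) (_ : Fintype k) (_ : DecidableEq k) (B : Matrix m k ℂ),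
      Bᴴ * B = 1 ∧ (2 : ℂ) • (B * Bᴴ) = 1 + Z := by
  obtain ⟨U, hUU, hUU', D, hspec⟩ : ∃ U : Matrix m m ℂ, Uᴴ * U = 1 ∧ U * Uᴴ = 1 ∧
      ∃ D : m → ℂ, Z = U * diagonal D * Uᴴ :=
    ⟨hZ.eigenvectorUnitary.1, Unitary.coe_star_mul_self hZ.eigenvectorUnitary,
      Unitary.coe_mul_star_self hZ.eigenvectorUnitary, _, hZ.spectral_theorem⟩
  have hD (i : m) : D i = 1 ∨ D i = -1 := by
    have h : diagonal D = Uᴴ * Z * U := by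
      calc _ = (Uᴴ * U) * diagonal D * (Uᴴ * U) := by rw [hUU, Matrix.one_mul, Matrix.mul_one]
        _ = _ := by rw [hspec]; simp only [Matrix.mul_assoc]
    have h2 : diagonal D * diagonal D = 1 := by
      calc _ = Uᴴ * Z * (U * Uᴴ) * Z * U := by rw [h]; simp only [Matrix.mul_assoc]
        _ = Uᴴ * (Z * Z) * U := by rw [hUU', Matrix.mul_one]; simp only [Matrix.mul_assoc]
        _ = 1 := by rw [hsq, Matrix.mul_one, hUU]
    rw [← mul_self_eq_one_iff]
    simpa using congrFun₂ h2 i i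
  classical
  refine ⟨{i // D i = 1}, inferInstance, inferInstance, U.submatrix id Subtype.val, ?_, ?_⟩
  · rw [conjTranspose_submatrix, ← submatrix_mul _ _ _ _ _ Function.bijective_id, hUU,
      submatrix_one _ Subtype.val_injective]
  · ext a b
    have h1 : (1 : Matrix m m ℂ) a b = ∑ i, U a i * Uᴴ i b := by
      rw [← hUU', Matrix.mul_apply]
    have h2 : Z a b = ∑ i, U a i * D i * Uᴴ i b := by
      rw [hspec, Matrix.mul_apply]
      simp only [mul_diagonal]
    have h3 : ∑ i : {i // D i = 1}, U a i * Uᴴ i b =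
        ∑ i, if D i = 1 then U a i * Uᴴ i b else 0 := by
      rw [← Finset.sum_filter]
      exact (Finset.sum_subtype _ (by simp) fun i => U a i * Uᴴ i b).symm
    rw [Matrix.add_apply, h1, h2, ← Finset.sum_add_distrib, Matrix.smul_apply, Matrix.mul_apply]
    refine (congrArg _ h3).trans ?_
    rw [smul_eq_mul, Finset.mul_sum]
    refine Finset.sum_congr rfl fun i _ => ?_
    split_ifs with h
    · rw [h]; ring
    · rw [(hD i).resolve_left h]; ring

/-- Two anticommuting Hermitian involutions are simultaneously unitarily equivalent to
`Z ⊗ 1` and `X ⊗ 1`. -/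
lemma exists_unitary_of_anticommute {m : Type} [Fintype m] [DecidableEq m] {X Z : Matrix m m ℂ}
    (hX : X.IsHermitian) (hXX : X * X = 1) (hZ : Z.IsHermitian) (hZZ : Z * Z = 1)
    (hXZ : X * Z = -(Z * X)) :
    ∃ (k : Type) (_ : Fintype k) (_ : DecidableEq k) (W : Matrix (Fin 2 × k) m ℂ),
      W * Wᴴ = 1 ∧ Wᴴ * W = 1 ∧ W * Z * Wᴴ = !![1, 0; 0, -1] ⊗ₖ 1 ∧
        W * X * Wᴴ = !![0, 1; 1, 0] ⊗ₖ 1 := by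
  obtain ⟨k, _, _, B, hB, hP⟩ := exists_isometry_of_involution hZ hZZ
  have hZB : Z * B = B := by
    have h : (2 : ℂ) • (B * Bᴴ) * B = (1 + Z) * B := by rw [hP]
    rw [Matrix.smul_mul, Matrix.mul_assoc, hB, Matrix.mul_one, Matrix.add_mul, Matrix.one_mul,
      two_smul] at h
    exact (add_left_cancel h).symm
  have hBZ : Bᴴ * Z = Bᴴ := by
    simpa [Matrix.conjTranspose_mul, hZ.eq] using congrArg conjTranspose hZB
  have hXX' {l : Type} (C : Matrix m l ℂ) : X * (X * C) = C := by
    rw [← Matrix.mul_assoc, hXX, Matrix.one_mul]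
  have hZX (C : Matrix m k ℂ) : Z * (X * C) = -(X * (Z * C)) := by
    rw [← Matrix.mul_assoc, ← Matrix.mul_assoc, hXZ, Matrix.neg_mul, neg_neg]
  have hBXB : Bᴴ * (X * B) = 0 := by
    have h : Bᴴ * (X * B) = -(Bᴴ * (X * B)) := by
      conv_lhs => rw [← hBZ, Matrix.mul_assoc, hZX, hZB, Matrix.mul_neg]
    ext i j
    exact self_eq_neg.mp (congrFun₂ h i j)
  refine ⟨k, inferInstance, inferInstance, blockRows ![Bᴴ, Bᴴ * X], ?_, ?_, ?_, ?_⟩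
  · suffices h : blockRows ![Bᴴ, Bᴴ * X] * (1 : Matrix m m ℂ) * (blockRows ![Bᴴ, Bᴴ * X])ᴴ = 1 by
      rwa [Matrix.mul_one] at h
    ext ⟨i, a⟩ ⟨j, b⟩
    rw [blockRows_mul_mul_conjTranspose_apply]
    fin_cases i <;> fin_cases j <;>
      simp [Matrix.mul_assoc, hX.eq, hB, hXX', hBXB, Matrix.one_apply]
  · rw [conjTranspose_blockRows_mul]
    apply smul_right_injective _ (two_ne_zero' ℂ)
    have h : (Bᴴ * X)ᴴ * (Bᴴ * X) = X * (B * Bᴴ) * X := by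
      simp [Matrix.mul_assoc, hX.eq]
    have hXZX : X * Z * X = -Z := by
      rw [hXZ, Matrix.neg_mul, Matrix.mul_assoc, hXX, Matrix.mul_one]
    change (2 : ℂ) • (Bᴴᴴ * Bᴴ + (Bᴴ * X)ᴴ * (Bᴴ * X)) = (2 : ℂ) • 1
    rw [h, conjTranspose_conjTranspose, smul_add, ← Matrix.smul_mul _ (X * _),
      ← Matrix.mul_smul X, hP, Matrix.mul_add, Matrix.add_mul, Matrix.mul_one, hXX, hXZX, two_smul]
    abel
  · ext ⟨i, a⟩ ⟨j, b⟩
    rw [blockRows_mul_mul_conjTranspose_apply]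
    fin_cases i <;> fin_cases j <;>
      simp [Matrix.mul_assoc, hX.eq, hB, hXX', hBXB, hZX, hZB]
  · ext ⟨i, a⟩ ⟨j, b⟩
    rw [blockRows_mul_mul_conjTranspose_apply]
    fin_cases i <;> fin_cases j <;>
      simp [Matrix.mul_assoc, hX.eq, hB, hXX', hBXB]

namespace IsIrreduciblePauliFamily

variable {ι : Type*} {m n : Type*} [Fintype m] [DecidableEq m] [Fintype n] [DecidableEq n]

lemma conj {G : ι → Matrix m m ℂ} (hG : IsIrreduciblePauliFamily G) {W : Matrix n m ℂ}
    (hW : W * Wᴴ = 1) (hW' : Wᴴ * W = 1) :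
    IsIrreduciblePauliFamily fun a => W * G a * Wᴴ := by
  have hmul (A B : Matrix m m ℂ) : W * A * Wᴴ * (W * B * Wᴴ) = W * (A * B) * Wᴴ := by
    calc _ = W * A * (Wᴴ * W) * B * Wᴴ := by simp only [Matrix.mul_assoc]
      _ = _ := by rw [hW']; simp only [Matrix.mul_assoc, Matrix.mul_one]
  refine ⟨fun a => isHermitian_mul_mul_conjTranspose W (hG.isHermitian a), fun a => ?_,
    fun a b => ?_, fun T hT => ?_⟩
  · rw [hmul, hG.mul_self, Matrix.mul_one, hW]
  · rw [hmul, hmul]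
    refine (hG.commute_or_anticommute a b).imp (fun h => by rw [h]) fun h => ?_
    rw [h, Matrix.mul_neg, Matrix.neg_mul]
  · have hback (A : Matrix n n ℂ) : W * (Wᴴ * A * W) * Wᴴ = A := by
      calc _ = (W * Wᴴ) * A * (W * Wᴴ) := by simp only [Matrix.mul_assoc]
        _ = A := by rw [hW, Matrix.one_mul, Matrix.mul_one]
    have hback' (A : Matrix m m ℂ) : Wᴴ * (W * A * Wᴴ) * W = A := by
      calc _ = (Wᴴ * W) * A * (Wᴴ * W) := by simp only [Matrix.mul_assoc]
        _ = A := by rw [hW', Matrix.one_mul, Matrix.mul_one]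
    obtain ⟨c, hc⟩ := hG.commutant (Wᴴ * T * W) fun a => by
      rw [← hback' (Wᴴ * T * W * G a), ← hmul, hback, hT a, ← hback' (G a * (Wᴴ * T * W)),
        ← hmul, hback]
    refine ⟨c, ?_⟩
    rw [← hback T, hc, Matrix.mul_smul, Matrix.smul_mul, Matrix.mul_one, hW]

lemma of_pauli_kronecker {H : ι → Matrix m m ℂ} {σ : ι → Matrix (Fin 2) (Fin 2) ℂ}
    (hσ : ∀ a, IsPauli (σ a)) (hG : IsIrreduciblePauliFamily fun a => σ a ⊗ₖ H a) :
    IsIrreduciblePauliFamily H := by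
  have h1 : (1 : Matrix (Fin 2) (Fin 2) ℂ) ≠ 0 := one_ne_zero
  refine ⟨fun a => ?_, fun a => ?_, fun a b => ?_, fun T hT => ?_⟩
  · apply kronecker_right_injective (hσ a).ne_zero
    simpa [conjTranspose_kronecker, (hσ a).isHermitian.eq] using (hG.isHermitian a).eq
  · apply kronecker_right_injective h1
    simpa [← mul_kronecker_mul, (hσ a).mul_self] using hG.mul_self a
  · have inj := kronecker_right_injective (m := m) ((hσ b).mul_ne_zero (hσ a))
    have h := hG.commute_or_anticommute a b
    simp only [← mul_kronecker_mul] at h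
    rcases (hσ a).commute_or_anticommute (hσ b) with hs | hs <;> rw [hs] at h
    · exact h.imp (fun h => inj h) fun h => inj (h.trans (kronecker_neg_right _ _).symm)
    · rw [kronecker_neg_left, neg_inj, neg_eq_iff_eq_neg] at h
      exact h.symm.imp (fun h => inj h) fun h => inj (h.trans (kronecker_neg_right _ _).symm)
  · obtain ⟨c, hc⟩ := hG.commutant (1 ⊗ₖ T) fun a => by
      rw [← mul_kronecker_mul, ← mul_kronecker_mul, hT a, one_mul, mul_one]
    refine ⟨c, kronecker_right_injective h1 ?_⟩
    simpa [kronecker_smul] using hc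

lemma of_adjoin_eq_top {G : ι → Matrix m m ℂ} (hherm : ∀ a, (G a).IsHermitian)
    (hsq : ∀ a, G a * G a = 1)
    (hcomm : ∀ a b, G a * G b = G b * G a ∨ G a * G b = -(G b * G a))
    (hgen : Algebra.adjoin ℂ (Set.range G) = ⊤) : IsIrreduciblePauliFamily G := by
  refine ⟨hherm, hsq, hcomm, fun T hT => ?_⟩
  have hle : Algebra.adjoin ℂ (Set.range G) ≤ Subalgebra.centralizer ℂ {T} := by
    refine Algebra.adjoin_le ?_
    rintro _ ⟨a, rfl⟩
    simpa [Set.mem_centralizer_iff] using hT a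
  have hall (A : Matrix m m ℂ) : T * A = A * T := by
    have : A ∈ Subalgebra.centralizer ℂ {T} := hle (hgen ▸ Algebra.mem_top)
    simpa [Subalgebra.mem_centralizer_iff] using this
  obtain ⟨c, hc⟩ := mem_range_scalar_of_commute_single (M := T) fun i j _ => (hall _).symm
  exact ⟨c, by rw [← hc, scalar_apply, smul_one_eq_diagonal]⟩

lemma subsingleton_of_commute {G : ι → Matrix m m ℂ} (hG : IsIrreduciblePauliFamily G)
    (hcomm : ∀ a b, G a * G b = G b * G a) : Subsingleton m := by
  refine ⟨fun i j => ?_⟩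
  by_contra hij
  obtain ⟨c, hc⟩ := hG.commutant (single i j 1) fun a => by
    obtain ⟨c, hc⟩ := hG.commutant (G a) (hcomm a)
    simp [hc]
  simpa [hij] using congrFun₂ hc i j

/-- The structure theorem over an arbitrary finite index type, with the unitary going directly to
the space of `n` qubits. -/
theorem exists_unitary (N : ℕ) : ∀ {m : Type} [Fintype m] [DecidableEq m] [Nonempty m]
    {G : ι → Matrix m m ℂ}, Fintype.card m = N → IsIrreduciblePauliFamily G →
    ∃ (n : ℕ) (V : Matrix (Fin n → Fin 2) m ℂ), V * Vᴴ = 1 ∧ Vᴴ * V = 1 ∧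
      ∀ a, ∃ ε : ℂ, (ε = 1 ∨ ε = -1) ∧ ∃ σ : Fin n → Matrix (Fin 2) (Fin 2) ℂ,
        (∀ k, IsPauli (σ k)) ∧
        ∀ x y, (V * G a * Vᴴ) x y = ε * ∏ k, σ k (x k) (y k) := by
  induction N using Nat.strong_induction_on with
  | _ N ih =>
    intro m _ _ _ G hN hG
    by_cases hcomm : ∀ a b, G a * G b = G b * G a
    · have := hG.subsingleton_of_commute hcomm
      obtain ⟨_⟩ := nonempty_unique m
      refine ⟨0, Matrix.of fun _ _ => 1, ?_, ?_, fun a => ⟨G a default default, ?_, 1, ?_, ?_⟩⟩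
      · ext i j
        simp [Matrix.mul_apply, Matrix.one_apply, Subsingleton.elim i j]
      · ext i j
        simp [Matrix.mul_apply, Matrix.one_apply, Subsingleton.elim i j]
      · rw [← mul_self_eq_one_iff]
        simpa [Matrix.mul_apply] using congrFun₂ (hG.mul_self a) default default
      · exact fun k => k.elim0
      · intro x y
        simp [Matrix.mul_apply]
    · push Not at hcomm
      obtain ⟨a, b, hab⟩ := hcomm
      obtain ⟨k, _, _, W, hW, hW', hWZ, hWX⟩ := exists_unitary_of_anticommute (hG.isHermitian a)
        (hG.mul_self a) (hG.isHermitian b) (hG.mul_self b)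
        ((hG.commute_or_anticommute a b).resolve_left hab)
      have hM := hG.conj hW hW'
      have hsplit (c : ι) : ∃ (σ : Matrix (Fin 2) (Fin 2) ℂ) (H : Matrix k k ℂ),
          IsPauli σ ∧ W * G c * Wᴴ = σ ⊗ₖ H :=
        exists_eq_pauli_kronecker _ (hWZ ▸ hM.commute_or_anticommute c b)
          (hWX ▸ hM.commute_or_anticommute c a)
      choose τ H hτ hH using hsplit
      have hHfam : IsIrreduciblePauliFamily H := of_pauli_kronecker hτ (by simpa only [hH] using hM)
      have hcard : 2 * Fintype.card k = Fintype.card m := by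
        simpa using Matrix.square_of_invertible _ _ hW hW'
      have hpos : 0 < Fintype.card m := Fintype.card_pos
      have : Nonempty k := Fintype.card_pos_iff.mp (by omega)
      obtain ⟨n, V, hV, hV', hVG⟩ := ih _ (by omega) rfl hHfam
      let e := (Fin.consEquiv fun _ : Fin (n + 1) => Fin 2).symm
      set I₂ : Matrix (Fin 2) (Fin 2) ℂ := 1
      have hVs : (I₂ ⊗ₖ V)ᴴ = I₂ ⊗ₖ Vᴴ := by
        rw [conjTranspose_kronecker, conjTranspose_one]
      have hVW : (I₂ ⊗ₖ V) * W * ((I₂ ⊗ₖ V) * W)ᴴ = 1 := by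
        calc _ = (I₂ ⊗ₖ V) * (W * Wᴴ) * (I₂ ⊗ₖ V)ᴴ := by
              simp only [conjTranspose_mul, Matrix.mul_assoc]
          _ = 1 := by
            rw [hW, Matrix.mul_one, hVs, ← mul_kronecker_mul, hV, one_mul, one_kronecker_one]
      have hVW' : ((I₂ ⊗ₖ V) * W)ᴴ * ((I₂ ⊗ₖ V) * W) = 1 := by
        calc _ = Wᴴ * ((I₂ ⊗ₖ V)ᴴ * (I₂ ⊗ₖ V)) * W := by
              simp only [conjTranspose_mul, Matrix.mul_assoc]
          _ = 1 := by
            rw [hVs, ← mul_kronecker_mul, hV', one_mul, one_kronecker_one, Matrix.mul_one, hW']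
      refine ⟨n + 1, ((I₂ ⊗ₖ V) * W).submatrix e id, ?_, ?_, fun c => ?_⟩
      · rw [conjTranspose_submatrix, ← submatrix_mul _ _ _ _ _ Function.bijective_id, hVW,
          submatrix_one_equiv]
      · rw [conjTranspose_submatrix, submatrix_mul_equiv, hVW', submatrix_id_id]
      · obtain ⟨ε, hε, σ, hσ, hσV⟩ := hVG c
        refine ⟨ε, hε, Fin.cons (τ c) σ, Fin.cases (hτ c) hσ, fun x y => ?_⟩
        have key : (I₂ ⊗ₖ V) * W * G c * ((I₂ ⊗ₖ V) * W)ᴴ = τ c ⊗ₖ (V * H c * Vᴴ) := by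
          calc _ = (I₂ ⊗ₖ V) * (W * G c * Wᴴ) * (I₂ ⊗ₖ V)ᴴ := by
                simp only [conjTranspose_mul, Matrix.mul_assoc]
            _ = _ := by
              rw [hH, hVs, ← mul_kronecker_mul, ← mul_kronecker_mul, one_mul, mul_one]
        have h := congrFun₂ key (e x) (e y)
        rw [kronecker_apply, hσV] at h
        refine h.trans ?_
        rw [Fin.prod_univ_succ]
        simp only [Fin.cons_zero, Fin.cons_succ]
        rw [mul_left_comm]
        rfl

end IsIrreduciblePauliFamily

/-- Lemma 5.9 (Lemma 12 of Bravyi–Vyalyi): Hermitian matrices squaring to the identity,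
pairwise commuting or anticommuting, and generating the full matrix algebra are, after a
simultaneous unitary change of basis and up to signs, tensor products of Pauli matrices
(under an identification of `Fin d` with binary strings of length `n`, where `d = 2^n`). -/
theorem pauli_structure_of_commuting_or_anticommuting_generators {d r : ℕ}
    (hd : 1 ≤ d) (hr : 1 ≤ r)
    (G : Fin r → Matrix (Fin d) (Fin d) ℂ)
    (hherm : ∀ a, (G a).IsHermitian)
    (hsq : ∀ a, G a * G a = 1)
    (hcomm : ∀ a b, G a * G b = G b * G a ∨ G a * G b = -(G b * G a))
    (hgen : Algebra.adjoin ℂ (Set.range G) = ⊤) :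
    ∃ n : ℕ, d = 2 ^ n ∧
      ∃ U : Matrix (Fin d) (Fin d) ℂ, U * Uᴴ = 1 ∧ Uᴴ * U = 1 ∧
        ∃ e : Fin d ≃ (Fin n → Fin 2),
          ∀ a : Fin r, ∃ ε : ℂ, (ε = 1 ∨ ε = -1) ∧
            ∃ σ : Fin n → Matrix (Fin 2) (Fin 2) ℂ,
              (∀ k, σ k = 1 ∨ σ k = !![0, 1; 1, 0] ∨
                    σ k = !![0, -Complex.I; Complex.I, 0] ∨ σ k = !![1, 0; 0, -1]) ∧
              ∀ x y : Fin d,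
                (U * G a * Uᴴ) x y = ε * ∏ k, (σ k) (e x k) (e y k) := by
  have : Nonempty (Fin d) := ⟨⟨0, hd⟩⟩
  obtain ⟨n, V, hV, hV', h⟩ := IsIrreduciblePauliFamily.exists_unitary d (Fintype.card_fin d)
    (IsIrreduciblePauliFamily.of_adjoin_eq_top hherm hsq hcomm hgen)
  have hcard : d = 2 ^ n := by
    simpa using (Matrix.square_of_invertible _ _ hV hV').symm
  let e : Fin d ≃ (Fin n → Fin 2) := Fintype.equivOfCardEq (by simpa using hcard)
  refine ⟨n, hcard, V.submatrix e id, ?_, ?_, e, fun a => ?_⟩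
  · rw [conjTranspose_submatrix, ← submatrix_mul _ _ _ _ _ Function.bijective_id, hV,
      submatrix_one_equiv]
  · rw [conjTranspose_submatrix, submatrix_mul_equiv, hV', submatrix_id_id]
  · obtain ⟨ε, hε, σ, hσ, hσV⟩ := h a
    exact ⟨ε, hε, σ, hσ, fun x y => hσV (e x) (e y)⟩
end
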